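/- The 2-abelian complexity sequence (P²_p(n))_{n≥0} of the period-doubling word is 2-regular. -/

import Mathlib

/-- The 2-kernel of a sequence `s : ℕ → ℤ`. -/
def kernel2 (s : ℕ → ℤ) : Set (ℕ → ℤ) :=
  {t | ∃ i j : ℕ, j < 2 ^ i ∧ t = fun n => s (2 ^ i * n + j)}

/-- A sequence is 2-regular if the ℤ-module spanned by its 2-kernel is finitely generated. -/
def IsTwoRegular (s : ℕ → ℤ) : Prop :=
  (Submodule.span ℤ (kernel2 s)).FG

/-- A sequence is 2-automatic if its 2-kernel is finite. -/
def IsTwoAutomatic (s : ℕ → ℤ) : Prop :=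
  (kernel2 s).Finite

/-- The period-doubling word, fixed point (starting with 0) of 0 ↦ 01, 1 ↦ 00:
its `n`-th letter is the parity of the 2-adic valuation of `n+1`. -/
def pd (n : ℕ) : ℕ := (n + 1).factorization 2 % 2

/-- The Thue–Morse word, fixed point (starting with 0) of 0 ↦ 01, 1 ↦ 10:
its `n`-th letter is the parity of the binary digit sum of `n`. -/
def tm (n : ℕ) : ℕ := (Nat.digits 2 n).sum % 2

/-- The 2-block coding `x = block(p, 2)` of the period-doubling word. -/
def xw (n : ℕ) : ℕ := 2 * pd n + pd (n + 1)

/-- The 2-block coding `y = block(t, 2)` of the Thue–Morse word. -/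
def yw (n : ℕ) : ℕ := 2 * tm n + tm (n + 1)

/-- The factor of an infinite word `w` of length `len` occurring at position `i`. -/
def factorAt (w : ℕ → ℕ) (i len : ℕ) : List ℕ :=
  (List.range len).map fun k => w (i + k)

/-- `u` is a factor of the infinite word `w`. -/
def IsFactor (w : ℕ → ℕ) (u : List ℕ) : Prop :=
  ∃ i, u = factorAt w i u.length

/-- Maximal number of 0's in a factor of `x` of length `n`. -/
noncomputable def M0 (n : ℕ) : ℕ := sSup {k | ∃ i, (factorAt xw i n).count 0 = k}

/-- Minimal number of 0's in a factor of `x` of length `n`. -/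
noncomputable def m0 (n : ℕ) : ℕ := sInf {k | ∃ i, (factorAt xw i n).count 0 = k}

noncomputable def D0 (n : ℕ) : ℕ := M0 n - m0 n

/-- Maximal number of 2's in a factor of `x` of length `n`. -/
noncomputable def M2c (n : ℕ) : ℕ := sSup {k | ∃ i, (factorAt xw i n).count 2 = k}

/-- Minimal number of 2's in a factor of `x` of length `n`. -/
noncomputable def m2c (n : ℕ) : ℕ := sInf {k | ∃ i, (factorAt xw i n).count 2 = k}

/-- The max-jump function for `M0`. -/
noncomputable def JM0 : ℕ → ℕ
  | 0 => 0
  | n + 1 => if M0 n < M0 (n + 1) then 1 else 0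

/-- The min-jump function for `m0`. -/
noncomputable def jm0 (n : ℕ) : ℕ := if m0 n < m0 (n + 1) then 1 else 0

/-- Maximal total number of 1's and 2's in a factor of `y` of length `n`. -/
noncomputable def M12 (n : ℕ) : ℕ :=
  sSup {k | ∃ i, (factorAt yw i n).count 1 + (factorAt yw i n).count 2 = k}

/-- Minimal total number of 1's and 2's in a factor of `y` of length `n`. -/
noncomputable def m12 (n : ℕ) : ℕ :=
  sInf {k | ∃ i, (factorAt yw i n).count 1 + (factorAt yw i n).count 2 = k}

noncomputable def D12 (n : ℕ) : ℕ := M12 n - m12 n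

/-- Maximal total number of 0's and 3's in a factor of `y` of length `n`. -/
noncomputable def M03 (n : ℕ) : ℕ :=
  sSup {k | ∃ i, (factorAt yw i n).count 0 + (factorAt yw i n).count 3 = k}

/-- Minimal total number of 0's and 3's in a factor of `y` of length `n`. -/
noncomputable def m03 (n : ℕ) : ℕ :=
  sInf {k | ∃ i, (factorAt yw i n).count 0 + (factorAt yw i n).count 3 = k}

/-- The max-jump function for `M03`. -/
noncomputable def JM03 (n : ℕ) : ℕ := if M03 (n - 1) < M03 n then 1 else 0

/-- The min-jump function for `m03`. -/
noncomputable def jm03 (n : ℕ) : ℕ := if m03 n < m03 (n + 1) then 1 else 0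

/-- Abelian complexity: the number of abelian equivalence classes (i.e. distinct
multisets of letters) of factors of `w` of length `n`. -/
noncomputable def abComplexity (w : ℕ → ℕ) (n : ℕ) : ℕ :=
  Set.ncard {m : Multiset ℕ | ∃ i, (↑(factorAt w i n) : Multiset ℕ) = m}

/-- The number of occurrences of `v` as a factor of `u`. -/
def countFactor (u v : List ℕ) : ℕ :=
  ((List.range (u.length + 1 - v.length)).filter
    fun i => decide ((u.drop i).take v.length = v)).length

/-- 2-abelian complexity: the number of 2-abelian equivalence classes of factors of `w`
of length `n`, where two words are 2-abelian equivalent when every word of length at most 2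
occurs equally often in both. -/
noncomputable def abel2Complexity (w : ℕ → ℕ) (n : ℕ) : ℕ :=
  Set.ncard {f : List ℕ → ℕ |
    ∃ i, f = fun v => if v.length ≤ 2 then countFactor (factorAt w i n) v else 0}

/-- The morphism φ : 0 ↦ 12, 1 ↦ 12, 2 ↦ 00. -/
def phiL : ℕ → List ℕ
  | 0 => [1, 2]
  | 1 => [1, 2]
  | 2 => [0, 0]
  | _ => []

/-- The morphism τ : 0 ↦ 0, 1 ↦ 2, 2 ↦ 1. -/
def tauL : ℕ → ℕ
  | 1 => 2
  | 2 => 1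
  | n => n

section Regularity

theorem isTwoRegular_of_mem {V : Submodule ℤ (ℕ → ℤ)} (hV : V.FG)
    (even_mem : ∀ t ∈ V, (fun n => t (2 * n)) ∈ V)
    (odd_mem : ∀ t ∈ V, (fun n => t (2 * n + 1)) ∈ V) {s : ℕ → ℤ} (hs : s ∈ V) :
    IsTwoRegular s := by
  have key : ∀ i j : ℕ, j < 2 ^ i → (fun n => s (2 ^ i * n + j)) ∈ V := by
    intro i
    induction i with
    | zero => intro j hj; simpa [show j = 0 by simpa using hj] using hs
    | succ i ih =>
      intro j hj
      rw [pow_succ] at hj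
      rcases lt_or_ge j (2 ^ i) with h | h
      · convert even_mem _ (ih j h) using 1
        ext n
        ring_nf
      · convert odd_mem _ (ih (j - 2 ^ i) (by omega)) using 1
        ext n
        congr 1
        zify [h]
        ring
  have : IsNoetherian ℤ V := isNoetherian_of_fg_of_noetherian V hV
  refine Submodule.FG.of_le hV (Submodule.span_le.2 ?_)
  rintro t ⟨i, j, hj, rfl⟩
  exact key i j hj

theorem mem_span_comp {G : Set (ℕ → ℤ)} (r : ℕ → ℕ)
    (h : ∀ g ∈ G, (fun n => g (r n)) ∈ Submodule.span ℤ G) :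
    ∀ t ∈ Submodule.span ℤ G, (fun n => t (r n)) ∈ Submodule.span ℤ G := by
  have : Submodule.span ℤ G ≤ (Submodule.span ℤ G).comap (LinearMap.funLeft ℤ ℤ r) :=
    Submodule.span_le.2 h
  exact fun t ht => this ht

end Regularity

section PeriodDoubling

theorem pd_even (k : ℕ) : pd (2 * k) = 0 := by
  rw [pd, Nat.factorization_eq_zero_of_not_dvd (by omega)]

theorem pd_lt_two (k : ℕ) : pd k < 2 := Nat.mod_lt _ two_pos

theorem pd_odd (k : ℕ) : pd (2 * k + 1) = 1 - pd k := by
  have : (2 * k + 1 + 1).factorization 2 = 1 + (k + 1).factorization 2 := by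
    rw [show 2 * k + 1 + 1 = 2 * (k + 1) by ring, Nat.factorization_mul (by simp) (by simp)]
    simp [Nat.prime_two.factorization]
  rw [pd, pd, this]
  omega

theorem pd_add_succ_le (k : ℕ) : pd k + pd (k + 1) ≤ 1 := by
  obtain ⟨m, rfl | rfl⟩ := k.even_or_odd'
  · rw [pd_even, pd_odd]; omega
  · rw [show 2 * m + 1 + 1 = 2 * (m + 1) by ring, pd_even, pd_odd]; omega

/-- The number of ones among the first `n` letters of the period-doubling word. -/
def pdOnes (n : ℕ) : ℤ := ∑ k ∈ Finset.range n, (pd k : ℤ)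

theorem pdOnes_succ (n : ℕ) : pdOnes (n + 1) = pdOnes n + pd n := Finset.sum_range_succ _ _

theorem pdOnes_even (n : ℕ) : pdOnes (2 * n) = n - pdOnes n := by
  induction n with
  | zero => simp [pdOnes]
  | succ n ih =>
    have := pd_lt_two n
    rw [show 2 * (n + 1) = 2 * n + 1 + 1 by ring, pdOnes_succ, pdOnes_succ, pdOnes_succ, ih,
      pd_even, pd_odd]
    push_cast [show pd n ≤ 1 by omega]
    ring

theorem pdOnes_odd (n : ℕ) : pdOnes (2 * n + 1) = n - pdOnes n := by
  rw [pdOnes_succ, pdOnes_even, pd_even]; simp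

/-- The numbers of ones in the factors of length `n` of the period-doubling word which
start with `a` and end with `b`. -/
def onesSet (a b n : ℕ) : Set ℤ :=
  {N | ∃ i j, j + 1 = i + n ∧ pd i = a ∧ pd j = b ∧ N = pdOnes (j + 1) - pdOnes i}

theorem mem_onesSet_pair {n : ℕ} {N : ℤ} :
    (∃ i j, j + 1 = i + n ∧ N = pdOnes (j + 1) - pdOnes i) ↔
      N ∈ onesSet 0 0 n ∨ N ∈ onesSet 0 1 n ∨ N ∈ onesSet 1 0 n ∨ N ∈ onesSet 1 1 n := by
  constructor
  · rintro ⟨i, j, h, hN⟩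
    have hi : pd i = 0 ∨ pd i = 1 := by have := pd_lt_two i; omega
    have hj : pd j = 0 ∨ pd j = 1 := by have := pd_lt_two j; omega
    rcases hi with hi | hi <;> rcases hj with hj | hj
    · exact .inl ⟨i, j, h, hi, hj, hN⟩
    · exact .inr (.inl ⟨i, j, h, hi, hj, hN⟩)
    · exact .inr (.inr (.inl ⟨i, j, h, hi, hj, hN⟩))
    · exact .inr (.inr (.inr ⟨i, j, h, hi, hj, hN⟩))
  · rintro (⟨i, j, h, -, -, hN⟩ | ⟨i, j, h, -, -, hN⟩ | ⟨i, j, h, -, -, hN⟩ |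
      ⟨i, j, h, -, -, hN⟩) <;> exact ⟨i, j, h, hN⟩

theorem mem_onesSet_left {b n : ℕ} {N : ℤ} :
    (∃ i j, j + 1 = i + n ∧ pd j = b ∧ N = pdOnes (j + 1) - pdOnes i) ↔
      N ∈ onesSet 0 b n ∨ N ∈ onesSet 1 b n := by
  constructor
  · rintro ⟨i, j, h, hj, hN⟩
    have hi : pd i = 0 ∨ pd i = 1 := by have := pd_lt_two i; omega
    exact hi.imp (fun hi => ⟨i, j, h, hi, hj, hN⟩) (fun hi => ⟨i, j, h, hi, hj, hN⟩)
  · rintro (⟨i, j, h, -, hj, hN⟩ | ⟨i, j, h, -, hj, hN⟩) <;> exact ⟨i, j, h, hj, hN⟩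

theorem mem_onesSet_right {a n : ℕ} {N : ℤ} :
    (∃ i j, j + 1 = i + n ∧ pd i = a ∧ N = pdOnes (j + 1) - pdOnes i) ↔
      N ∈ onesSet a 0 n ∨ N ∈ onesSet a 1 n := by
  constructor
  · rintro ⟨i, j, h, hi, hN⟩
    have hj : pd j = 0 ∨ pd j = 1 := by have := pd_lt_two j; omega
    exact hj.imp (fun hj => ⟨i, j, h, hi, hj, hN⟩) (fun hj => ⟨i, j, h, hi, hj, hN⟩)
  · rintro (⟨i, j, h, hi, -, hN⟩ | ⟨i, j, h, hi, -, hN⟩) <;> exact ⟨i, j, h, hi, hN⟩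

/-- A factor of even length `2 * m` starting at an even position. -/
theorem exists_even_even {m : ℕ} {N : ℤ} {P : ℕ → ℕ → Prop} :
    (∃ k t, t + 1 = k + m ∧ P k t ∧ N = pdOnes (2 * t + 1 + 1) - pdOnes (2 * k)) ↔
      ∃ k t, t + 1 = k + m ∧ P k t ∧ m - N = pdOnes (t + 1) - pdOnes k := by
  refine exists_congr fun k => exists_congr fun t => and_congr_right fun h => and_congr_right
    fun _ => ?_
  rw [show 2 * t + 1 + 1 = 2 * (t + 1) by ring, pdOnes_even, pdOnes_even]
  have : (t : ℤ) + 1 = k + m := mod_cast h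
  push_cast
  constructor <;> intro <;> linarith

theorem onesSet_zero_one_even {m : ℕ} {N : ℤ} :
    N ∈ onesSet 0 1 (2 * m) ↔ (m - N : ℤ) ∈ onesSet 0 0 m ∨ (m - N : ℤ) ∈ onesSet 1 0 m := by
  rw [← mem_onesSet_left, ← exists_even_even (P := fun _ t => pd t = 0)]
  constructor
  · rintro ⟨i, j, h, hi, hj, hN⟩
    obtain ⟨t, rfl | rfl⟩ := j.even_or_odd'
    · simp [pd_even] at hj
    obtain ⟨k, rfl⟩ : ∃ k, i = 2 * k := ⟨i / 2, by omega⟩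
    rw [pd_odd] at hj
    exact ⟨k, t, by omega, by omega, hN⟩
  · rintro ⟨k, t, h, ht, hN⟩
    exact ⟨2 * k, 2 * t + 1, by omega, pd_even k, by rw [pd_odd]; omega, hN⟩

theorem exists_odd_even {m : ℕ} {N : ℤ} {P : ℕ → ℕ → Prop} :
    (∃ k t, t + 1 = k + m ∧ P k t ∧ N = pdOnes (2 * (t + 1) + 1) - pdOnes (2 * k + 1)) ↔
      ∃ k t, t + 1 = k + m ∧ P k t ∧ m - N = pdOnes (t + 1) - pdOnes k := by
  refine exists_congr fun k => exists_congr fun t => and_congr_right fun h => and_congr_right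
    fun _ => ?_
  rw [pdOnes_odd, pdOnes_odd]
  have : (t : ℤ) + 1 = k + m := mod_cast h
  push_cast
  constructor <;> intro <;> linarith

theorem onesSet_one_zero_even {m : ℕ} (hm : 0 < m) {N : ℤ} :
    N ∈ onesSet 1 0 (2 * m) ↔ (m - N : ℤ) ∈ onesSet 0 0 m ∨ (m - N : ℤ) ∈ onesSet 0 1 m := by
  rw [← mem_onesSet_right, ← exists_odd_even (P := fun k _ => pd k = 0)]
  constructor
  · rintro ⟨i, j, h, hi, hj, hN⟩
    obtain ⟨k, rfl | rfl⟩ := i.even_or_odd'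
    · simp [pd_even] at hi
    obtain ⟨t, rfl⟩ : ∃ t, j = 2 * (t + 1) := ⟨j / 2 - 1, by omega⟩
    rw [pd_odd] at hi
    exact ⟨k, t, by omega, by omega, hN⟩
  · rintro ⟨k, t, h, ht, hN⟩
    exact ⟨2 * k + 1, 2 * (t + 1), by omega, by rw [pd_odd]; omega, pd_even _, hN⟩

theorem onesSet_zero_zero_even {m : ℕ} (hm : 0 < m) {N : ℤ} :
    N ∈ onesSet 0 0 (2 * m) ↔ (m - N : ℤ) ∈ onesSet 0 1 m ∨ (m - N : ℤ) ∈ onesSet 1 0 m ∨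
      (m - N : ℤ) ∈ onesSet 1 1 m := by
  have h₁ := mem_onesSet_left (b := 1) (n := m) (N := m - N)
  have h₂ := mem_onesSet_right (a := 1) (n := m) (N := m - N)
  rw [← exists_even_even (P := fun _ t => pd t = 1)] at h₁
  rw [← exists_odd_even (P := fun k _ => pd k = 1)] at h₂
  suffices N ∈ onesSet 0 0 (2 * m) ↔
      (∃ k t, t + 1 = k + m ∧ pd t = 1 ∧ N = pdOnes (2 * t + 1 + 1) - pdOnes (2 * k)) ∨
      (∃ k t, t + 1 = k + m ∧ pd k = 1 ∧
        N = pdOnes (2 * (t + 1) + 1) - pdOnes (2 * k + 1)) by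
    rw [this, h₁, h₂]; tauto
  constructor
  · rintro ⟨i, j, h, hi, hj, hN⟩
    obtain ⟨k, rfl | rfl⟩ := i.even_or_odd'
    · obtain ⟨t, rfl⟩ : ∃ t, j = 2 * t + 1 := ⟨j / 2, by omega⟩
      have := pd_lt_two t
      rw [pd_odd] at hj
      exact .inl ⟨k, t, by omega, by omega, hN⟩
    · obtain ⟨t, rfl⟩ : ∃ t, j = 2 * (t + 1) := ⟨j / 2 - 1, by omega⟩
      have := pd_lt_two k
      rw [pd_odd] at hi
      exact .inr ⟨k, t, by omega, by omega, hN⟩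
  · rintro (⟨k, t, h, ht, hN⟩ | ⟨k, t, h, hk, hN⟩)
    · exact ⟨2 * k, 2 * t + 1, by omega, pd_even k, by rw [pd_odd]; omega, hN⟩
    · exact ⟨2 * k + 1, 2 * (t + 1), by omega, by rw [pd_odd]; omega, pd_even _, hN⟩

theorem onesSet_one_one_even {m : ℕ} {N : ℤ} : N ∉ onesSet 1 1 (2 * m) := by
  rintro ⟨i, j, h, hi, hj, -⟩
  obtain ⟨k, rfl | rfl⟩ := i.even_or_odd'
  · simp [pd_even] at hi
  · obtain ⟨t, rfl⟩ : ∃ t, j = 2 * t := ⟨j / 2, by omega⟩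
    simp [pd_even] at hj

/-- Factors of length `2 * m + 1` starting at an odd position. -/
theorem mem_onesSet_odd_iff {m a b : ℕ} (ha : a < 2) (hb : b < 2) {N : ℤ} :
    (∃ k t, t + 1 = k + (m + 1) ∧ pd (2 * k + 1) = a ∧ pd (2 * t + 1) = b ∧
        N = pdOnes (2 * t + 1 + 1) - pdOnes (2 * k + 1)) ↔
      (m + 1 - N : ℤ) ∈ onesSet (1 - a) (1 - b) (m + 1) := by
  refine exists_congr fun k => exists_congr fun t => and_congr_right fun h => ?_
  have hk := pd_lt_two k
  have ht := pd_lt_two t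
  have : (t : ℤ) + 1 = k + (m + 1) := mod_cast h
  rw [show 2 * t + 1 + 1 = 2 * (t + 1) by ring, pdOnes_even, pdOnes_odd, pd_odd, pd_odd]
  push_cast
  refine and_congr (by omega) (and_congr (by omega) ?_)
  constructor <;> intro <;> linarith

theorem onesSet_odd {m a b : ℕ} (ha : a < 2) (hb : b < 2) (hab : 0 < a + b) {N : ℤ} :
    N ∈ onesSet a b (2 * m + 1) ↔ (m + 1 - N : ℤ) ∈ onesSet (1 - a) (1 - b) (m + 1) := by
  rw [← mem_onesSet_odd_iff ha hb]
  constructor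
  · rintro ⟨i, j, h, hi, hj, hN⟩
    obtain ⟨k, rfl | rfl⟩ := i.even_or_odd'
    · obtain ⟨t, rfl⟩ : ∃ t, j = 2 * t := ⟨j / 2, by omega⟩
      rw [pd_even] at hi hj
      omega
    · obtain ⟨t, rfl⟩ : ∃ t, j = 2 * t + 1 := ⟨j / 2, by omega⟩
      exact ⟨k, t, by omega, hi, hj, hN⟩
  · rintro ⟨k, t, h, hi, hj, hN⟩
    exact ⟨_, _, by omega, hi, hj, hN⟩

theorem onesSet_zero_zero_odd {m : ℕ} (hm : 0 < m) {N : ℤ} :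
    N ∈ onesSet 0 0 (2 * m + 1) ↔
      ((m - N : ℤ) ∈ onesSet 0 0 m ∨ (m - N : ℤ) ∈ onesSet 0 1 m ∨
        (m - N : ℤ) ∈ onesSet 1 0 m ∨ (m - N : ℤ) ∈ onesSet 1 1 m) ∨
      (m + 1 - N : ℤ) ∈ onesSet 1 1 (m + 1) := by
  rw [← mem_onesSet_pair, ← mem_onesSet_odd_iff (a := 0) (b := 0) two_pos two_pos]
  constructor
  · rintro ⟨i, j, h, hi, hj, hN⟩
    obtain ⟨k, rfl | rfl⟩ := i.even_or_odd'
    · obtain ⟨t, rfl⟩ : ∃ t, j = 2 * (t + 1) := ⟨j / 2 - 1, by omega⟩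
      refine .inl ⟨k, t, by omega, ?_⟩
      rw [pdOnes_odd, pdOnes_even] at hN
      push_cast at hN
      omega
    · obtain ⟨t, rfl⟩ : ∃ t, j = 2 * t + 1 := ⟨j / 2, by omega⟩
      exact .inr ⟨k, t, by omega, hi, hj, hN⟩
  · rintro (⟨k, t, h, hN⟩ | ⟨k, t, h, hi, hj, hN⟩)
    · refine ⟨2 * k, 2 * (t + 1), by omega, pd_even _, pd_even _, ?_⟩
      rw [pdOnes_odd, pdOnes_even]
      push_cast
      omega
    · exact ⟨_, _, by omega, hi, hj, hN⟩

end PeriodDoubling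

section Endpoints

/-- The increments of `pdMax`; they vanish at even arguments. -/
def maxStep (n : ℕ) : ℤ :=
  if n % 4 = 1 then 1 else if n % 4 = 3 then maxStep ((n + 1) / 4) else 0
termination_by n

/-- `maxStep` moved to the even integers. -/
def evenStep (n : ℕ) : ℤ := if n % 2 = 0 then maxStep (n / 2) else 0

/-- The parity of `n` as an integer. -/
def parity (n : ℕ) : ℤ := (n % 2 : ℕ)

/-- For even `n`, the gap between the maximal number of ones in all factors of length `n` of the
period-doubling word and in those starting and ending with `0`. -/
def zeroGap (n : ℕ) : ℤ := if n % 2 = 0 then evenStep (n / 2) + parity (n / 2) else 0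

/-- For odd `n`, one less than the gap between the minimal number of ones in factors of length `n`
of the period-doubling word and in those starting and ending with `1`. -/
def oneGap (n : ℕ) : ℤ := if n % 2 = 0 then 0 else zeroGap ((n + 1) / 2)

/-- The maximal number of ones in a factor of length `n` of the period-doubling word. -/
def pdMax (n : ℕ) : ℤ := ∑ k ∈ Finset.range n, maxStep (k + 1)

/-- The minimal number of ones in a factor of length `n` of the period-doubling word. -/
def pdMin (n : ℕ) : ℤ := ∑ k ∈ Finset.range n, (parity k - evenStep (k + 1))

theorem parity_even (n : ℕ) : parity (2 * n) = 0 := by simp [parity]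

theorem parity_odd (n : ℕ) : parity (2 * n + 1) = 1 := by
  simp [parity, show (2 * n + 1) % 2 = 1 by omega]

theorem parity_succ (n : ℕ) : parity (n + 1) = 1 - parity n := by
  simp only [parity]; omega

theorem maxStep_even (n : ℕ) : maxStep (2 * n) = 0 := by
  rw [maxStep, if_neg (by omega), if_neg (by omega)]

theorem evenStep_even (n : ℕ) : evenStep (2 * n) = maxStep n := by
  simp [evenStep]

theorem evenStep_odd (n : ℕ) : evenStep (2 * n + 1) = 0 := by
  rw [evenStep, if_neg (by omega)]

theorem maxStep_odd (n : ℕ) : maxStep (2 * n + 1) = 1 - parity n + evenStep (n + 1) := by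
  rw [maxStep]
  obtain ⟨m, rfl | rfl⟩ := n.even_or_odd'
  · rw [if_pos (by omega), parity_even, evenStep_odd]; simp
  · rw [if_neg (by omega), if_pos (by omega), parity_odd,
      show 2 * m + 1 + 1 = 2 * (m + 1) by ring, evenStep_even,
      show (2 * (2 * m + 1) + 1 + 1) / 4 = m + 1 by omega]
    simp

theorem zeroGap_even (n : ℕ) : zeroGap (2 * n) = evenStep n + parity n := by simp [zeroGap]

theorem zeroGap_odd (n : ℕ) : zeroGap (2 * n + 1) = 0 := by rw [zeroGap, if_neg (by omega)]

theorem oneGap_even (n : ℕ) : oneGap (2 * n) = 0 := by simp [oneGap]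

theorem oneGap_odd (n : ℕ) : oneGap (2 * n + 1) = zeroGap (n + 1) := by
  rw [oneGap, if_neg (by omega), show (2 * n + 1 + 1) / 2 = n + 1 by omega]

theorem parity_eq (n : ℕ) : parity n = 0 ∨ parity n = 1 := by
  simp only [parity]; omega

theorem maxStep_eq (n : ℕ) : maxStep n = 0 ∨ maxStep n = 1 := by
  induction n using Nat.strong_induction_on with
  | _ n ih =>
    rw [maxStep]
    split_ifs
    · simp
    · exact ih _ (by omega)
    · simp

theorem evenStep_eq (n : ℕ) : evenStep n = 0 ∨ evenStep n = 1 ∧ parity n = 0 := by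
  obtain ⟨m, rfl | rfl⟩ := n.even_or_odd'
  · rw [evenStep_even, parity_even]; have := maxStep_eq m; omega
  · rw [evenStep_odd]; simp

theorem maxStep_eq_or (n : ℕ) : maxStep n = 0 ∨ maxStep n = 1 ∧ parity n = 1 := by
  obtain ⟨m, rfl | rfl⟩ := n.even_or_odd'
  · simp [maxStep_even]
  · rw [parity_odd]; have := maxStep_eq (2 * m + 1); omega

theorem zeroGap_eq (n : ℕ) : zeroGap n = 0 ∨ zeroGap n = 1 ∧ parity n = 0 := by
  obtain ⟨m, rfl | rfl⟩ := n.even_or_odd'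
  · rw [zeroGap_even, parity_even]
    have := evenStep_eq m
    have := parity_eq m
    omega
  · simp [zeroGap_odd]

theorem oneGap_eq (n : ℕ) : oneGap n = 0 ∨ oneGap n = 1 ∧ parity n = 1 := by
  obtain ⟨m, rfl | rfl⟩ := n.even_or_odd'
  · simp [oneGap_even]
  · rw [oneGap_odd, parity_odd]; have := zeroGap_eq (m + 1); omega

theorem pdMax_succ (n : ℕ) : pdMax (n + 1) = pdMax n + maxStep (n + 1) :=
  Finset.sum_range_succ _ _

theorem pdMin_succ (n : ℕ) : pdMin (n + 1) = pdMin n + (parity n - evenStep (n + 1)) :=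
  Finset.sum_range_succ _ _

theorem pdMax_even (n : ℕ) : pdMax (2 * n) = n - pdMin n := by
  induction n with
  | zero => simp [pdMax, pdMin]
  | succ n ih =>
    have h := maxStep_even (n + 1)
    rw [show 2 * (n + 1) = 2 * n + 1 + 1 by ring] at h ⊢
    rw [pdMax_succ, pdMax_succ, pdMin_succ, ih, h, maxStep_odd]
    push_cast
    ring

theorem pdMin_even (n : ℕ) : pdMin (2 * n) = n - pdMax n := by
  induction n with
  | zero => simp [pdMax, pdMin]
  | succ n ih =>
    have h := evenStep_even (n + 1)
    rw [show 2 * (n + 1) = 2 * n + 1 + 1 by ring] at h ⊢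
    rw [pdMin_succ, pdMin_succ, pdMax_succ, ih, h, evenStep_odd, parity_even, parity_odd]
    push_cast
    ring

/-- The difference between the maximal and minimal number of ones in the factors of length `n`
of the period-doubling word. -/
def pdWidth (n : ℕ) : ℤ := pdMax n - pdMin n

theorem pdWidth_even (n : ℕ) : pdWidth (2 * n) = pdWidth n := by
  rw [pdWidth, pdWidth, pdMax_even, pdMin_even]; ring

theorem pdWidth_odd (n : ℕ) :
    pdWidth (2 * n + 1) = pdWidth n + (1 - parity n + evenStep (n + 1)) := by
  rw [← pdWidth_even n, pdWidth, pdWidth, pdMax_succ, pdMin_succ, parity_even, evenStep_odd,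
    maxStep_odd]
  ring

theorem pdWidth_pos {n : ℕ} (hn : 0 < n) : 1 ≤ pdWidth n := by
  induction n using Nat.strong_induction_on with
  | _ n ih =>
    obtain ⟨m, rfl | rfl⟩ := n.even_or_odd'
    · rw [pdWidth_even]; exact ih m (by omega) (by omega)
    · rw [pdWidth_odd]
      rcases m.eq_zero_or_pos with rfl | hm
      · simp [pdWidth, pdMax, pdMin, parity, evenStep]
      · have := ih m (by omega) hm
        have := parity_eq m
        have := evenStep_eq (m + 1)
        omega

theorem two_le_pdWidth (n : ℕ) : maxStep n = 0 ∨ oneGap n = 0 ∨ 2 ≤ pdWidth n := by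
  rcases maxStep_eq n with h | h
  · exact .inl h
  rcases oneGap_eq n with h' | ⟨h', -⟩
  · exact .inr (.inl h')
  refine .inr (.inr ?_)
  obtain ⟨m, rfl | rfl⟩ := n.even_or_odd'
  · simp [maxStep_even] at h
  · rw [maxStep_odd] at h
    rw [oneGap_odd] at h'
    have := zeroGap_eq (m + 1)
    have := parity_succ m
    have hm : m ≠ 0 := by
      rintro rfl
      simp [parity] at *
      omega
    have := pdWidth_pos (Nat.pos_of_ne_zero hm)
    rw [pdWidth_odd]
    omega

theorem mem_onesSet_iff {n : ℕ} (hn : 0 < n) (N : ℤ) :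
    (N ∈ onesSet 0 0 n ↔ pdMin n ≤ N ∧ N ≤ pdMax n - maxStep n - zeroGap n) ∧
    (N ∈ onesSet 0 1 n ↔ pdMin n + evenStep n + parity n ≤ N ∧ N ≤ pdMax n - maxStep n) ∧
    (N ∈ onesSet 1 0 n ↔ pdMin n + evenStep n + parity n ≤ N ∧ N ≤ pdMax n - maxStep n) ∧
    (N ∈ onesSet 1 1 n ↔ parity n = 1 ∧ pdMin n + 1 + oneGap n ≤ N ∧ N ≤ pdMax n) := by
  induction n using Nat.strong_induction_on generalizing N with
  | _ n ih =>
    obtain ⟨m, rfl | rfl⟩ := n.even_or_odd'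
    · have hm : 0 < m := by omega
      rw [onesSet_zero_zero_even hm, onesSet_zero_one_even, onesSet_one_zero_even hm,
        iff_false_intro onesSet_one_one_even, pdMin_even, pdMax_even, maxStep_even, zeroGap_even,
        evenStep_even, parity_even]
      obtain ⟨h₁, h₂, h₃, h₄⟩ := ih m (by omega) hm (m - N)
      rw [h₁, h₂, h₃, h₄]
      have hW := pdWidth_pos hm
      have hW' := two_le_pdWidth m
      rw [pdWidth] at hW hW'
      have := parity_eq m
      have := evenStep_eq m
      have := maxStep_eq_or m
      have := zeroGap_eq m
      have := oneGap_eq m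
      refine ⟨?_, ?_, ?_, by simp⟩ <;> omega
    · rcases m.eq_zero_or_pos with rfl | hm
      · have hp0 : pd 0 = 0 := pd_even 0
        have hp1 : pd 1 = 1 := by simpa [hp0] using pd_odd 0
        have key : ∀ a b, N ∈ onesSet a b 1 ↔ a = b ∧ a < 2 ∧ N = a := by
          intro a b
          constructor
          · rintro ⟨i, j, h, rfl, rfl, hN⟩
            obtain rfl : i = j := by omega
            rw [pdOnes_succ] at hN
            exact ⟨rfl, pd_lt_two i, by omega⟩
          · rintro ⟨rfl, h, rfl⟩
            obtain rfl | rfl : a = 0 ∨ a = 1 := by omega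
            · exact ⟨0, 0, rfl, hp0, hp0, by simp [pdOnes, hp0]⟩
            · exact ⟨1, 1, rfl, hp1, hp1, by simp [pdOnes, Finset.sum_range_succ, hp1]⟩
        simp only [mul_zero, zero_add, key]
        have h₁ : maxStep 1 = 1 := by rw [maxStep]; simp
        have h₂ : pdMax 1 = 1 := by simp [pdMax, h₁]
        have h₃ : pdMin 1 = 0 := by simp [pdMin, parity, evenStep]
        rw [h₁, h₂, h₃, show zeroGap 1 = 0 from zeroGap_odd 0,
          show evenStep 1 = 0 from evenStep_odd 0, show parity 1 = 1 from parity_odd 0,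
          show oneGap 1 = 0 by rw [← zeroGap_odd 0]; exact oneGap_odd 0]
        norm_num
        omega
      · rw [onesSet_zero_zero_odd hm, onesSet_odd (by omega) (by omega) (by omega),
          onesSet_odd (by omega) (by omega) (by omega),
          onesSet_odd (by omega) (by omega) (by omega), pdMin_succ, pdMax_succ, pdMin_even,
          pdMax_even, maxStep_odd, zeroGap_odd, evenStep_odd, parity_odd, parity_even, oneGap_odd]
        obtain ⟨h₁, h₂, h₃, h₄⟩ := ih m (by omega) hm (m - N)
        obtain ⟨k₁, k₂, k₃, k₄⟩ := ih (m + 1) (by omega) (by omega) (m + 1 - N)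
        simp only [Nat.sub_zero, Nat.sub_self]
        rw [h₁, h₂, h₃, h₄, k₁, k₂, k₃, k₄, pdMin_succ, pdMax_succ, parity_succ]
        have hW := pdWidth_pos hm
        have hW' := two_le_pdWidth m
        rw [pdWidth] at hW hW'
        have := parity_eq m
        have := parity_succ m
        have := evenStep_eq m
        have := maxStep_eq_or m
        have := zeroGap_eq m
        have := oneGap_eq m
        have := evenStep_eq (m + 1)
        have := maxStep_eq_or (m + 1)
        have := zeroGap_eq (m + 1)
        have := oneGap_eq (m + 1)
        rw [true_and]
        refine ⟨?_, ?_, ?_, ?_⟩ <;> omega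

end Endpoints

section Counting

theorem countFactor_nil (w : ℕ → ℕ) (i n : ℕ) : countFactor (factorAt w i n) [] = n + 1 := by
  simp [countFactor, factorAt]

theorem countFactor_singleton (w : ℕ → ℕ) (i n x : ℕ) :
    countFactor (factorAt w i n) [x] = ∑ k ∈ Finset.range n, if w (i + k) = x then 1 else 0 := by
  have h : (List.range n).filter (fun k => decide (((factorAt w i n).drop k).take 1 = [x])) =
      (List.range n).filter (fun k => decide (w (i + k) = x)) := by
    refine List.filter_congr fun k hk => ?_
    have hk : k < n := List.mem_range.1 hk
    rw [List.drop_eq_getElem_cons (by simpa [factorAt] using hk)]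
    simp [factorAt]
  rw [← Finset.card_filter, countFactor]
  simp only [List.length_singleton, Nat.add_sub_cancel]
  rw [show (factorAt w i n).length = n by simp [factorAt], h]
  rfl

theorem countFactor_pair (w : ℕ → ℕ) (i n x y : ℕ) :
    countFactor (factorAt w i (n + 1)) [x, y] =
      ∑ k ∈ Finset.range n, if w (i + k) = x ∧ w (i + k + 1) = y then 1 else 0 := by
  have h : (List.range n).filter
        (fun k => decide (((factorAt w i (n + 1)).drop k).take 2 = [x, y])) =
      (List.range n).filter (fun k => decide (w (i + k) = x ∧ w (i + k + 1) = y)) := by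
    refine List.filter_congr fun k hk => ?_
    have hk : k < n := List.mem_range.1 hk
    rw [List.drop_eq_getElem_cons (by simp [factorAt]; omega),
      List.drop_eq_getElem_cons (by simp [factorAt]; omega)]
    simp [factorAt, add_assoc]
  rw [← Finset.card_filter, countFactor]
  rw [show (factorAt w i (n + 1)).length + 1 - [x, y].length = n by simp [factorAt],
    show [x, y].length = 2 from rfl, h]
  rfl

theorem countFactor_pd_one (i n : ℕ) :
    (countFactor (factorAt pd i n) [1] : ℤ) = pdOnes (i + n) - pdOnes i := by
  rw [countFactor_singleton]
  induction n with
  | zero => simp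
  | succ n ih =>
    rw [Finset.sum_range_succ, Nat.cast_add, ih, ← add_assoc, pdOnes_succ]
    have := pd_lt_two (i + n)
    split_ifs <;> push_cast <;> omega

theorem countFactor_pd_zero (i n : ℕ) :
    (countFactor (factorAt pd i n) [0] : ℤ) = n - (pdOnes (i + n) - pdOnes i) := by
  rw [countFactor_singleton]
  induction n with
  | zero => simp
  | succ n ih =>
    rw [Finset.sum_range_succ, Nat.cast_add, ih, ← add_assoc, pdOnes_succ]
    have := pd_lt_two (i + n)
    split_ifs <;> push_cast <;> omega

theorem countFactor_pd_one_zero (i n : ℕ) :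
    (countFactor (factorAt pd i (n + 1)) [1, 0] : ℤ) =
      pdOnes (i + n + 1) - pdOnes i - pd (i + n) := by
  rw [countFactor_pair]
  induction n with
  | zero => simp [pdOnes_succ]
  | succ n ih =>
    rw [Finset.sum_range_succ, Nat.cast_add, ih, ← add_assoc, pdOnes_succ (i + n + 1)]
    have := pd_add_succ_le (i + n)
    have := pdOnes_succ (i + n)
    split_ifs <;> push_cast <;> omega

theorem countFactor_pd_zero_one (i n : ℕ) :
    (countFactor (factorAt pd i (n + 1)) [0, 1] : ℤ) =
      pdOnes (i + n + 1) - pdOnes i - pd i := by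
  rw [countFactor_pair]
  induction n with
  | zero => simp [pdOnes_succ]
  | succ n ih =>
    rw [Finset.sum_range_succ, Nat.cast_add, ih, ← add_assoc, pdOnes_succ (i + n + 1)]
    have := pd_add_succ_le (i + n)
    split_ifs <;> push_cast <;> omega

theorem countFactor_pd_zero_zero (i n : ℕ) :
    (countFactor (factorAt pd i (n + 1)) [0, 0] : ℤ) =
      n - 2 * (pdOnes (i + n + 1) - pdOnes i) + pd i + pd (i + n) := by
  rw [countFactor_pair]
  induction n with
  | zero => simp [pdOnes_succ]; ring
  | succ n ih =>
    rw [Finset.sum_range_succ, Nat.cast_add, ih, ← add_assoc, pdOnes_succ (i + n + 1)]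
    have := pd_add_succ_le (i + n)
    split_ifs <;> push_cast <;> omega

/-- The first letter, the last letter and the number of ones of the factor of length `n + 1`
of the period-doubling word at position `i`. -/
def profile (n i : ℕ) : ℕ × ℕ × ℤ := (pd i, pd (i + n), pdOnes (i + n + 1) - pdOnes i)

theorem profile_eq_iff (n i j : ℕ) :
    ((fun v : List ℕ => if v.length ≤ 2 then countFactor (factorAt pd i (n + 1)) v else 0) =
      fun v => if v.length ≤ 2 then countFactor (factorAt pd j (n + 1)) v else 0) ↔
      profile n i = profile n j := by
  simp only [profile, Prod.mk.injEq]
  constructor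
  · intro h
    have h₁ := congrFun h [1]
    have h₂ := congrFun h [1, 0]
    have h₃ := congrFun h [0, 1]
    simp only [List.length_cons, List.length_nil, zero_add, Nat.reduceAdd, Nat.reduceLeDiff,
      le_refl, if_true] at h₁ h₂ h₃
    zify at h₁ h₂ h₃
    rw [countFactor_pd_one, countFactor_pd_one, ← add_assoc, ← add_assoc] at h₁
    rw [countFactor_pd_one_zero, countFactor_pd_one_zero] at h₂
    rw [countFactor_pd_zero_one, countFactor_pd_zero_one] at h₃
    omega
  · rintro ⟨h₁, h₂, h₃⟩
    funext v
    split_ifs with hv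
    · match v, hv with
      | [], _ => rw [countFactor_nil, countFactor_nil]
      | [0], _ =>
        zify
        rw [countFactor_pd_zero, countFactor_pd_zero, ← add_assoc, ← add_assoc, h₃]
      | [1], _ =>
        zify
        rw [countFactor_pd_one, countFactor_pd_one, ← add_assoc, ← add_assoc, h₃]
      | [x + 2], _ =>
        have h : ∀ k, pd k ≠ x + 2 := fun k => by have := pd_lt_two k; omega
        simp [countFactor_singleton, h]
      | [0, 0], _ =>
        zify
        rw [countFactor_pd_zero_zero, countFactor_pd_zero_zero, h₁, h₂, h₃]
      | [0, 1], _ =>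
        zify
        rw [countFactor_pd_zero_one, countFactor_pd_zero_one, h₁, h₃]
      | [1, 0], _ =>
        zify
        rw [countFactor_pd_one_zero, countFactor_pd_one_zero, h₂, h₃]
      | [1, 1], _ =>
        have h : ∀ k, ¬(pd k = 1 ∧ pd (k + 1) = 1) := fun k => by
          have := pd_add_succ_le k; omega
        simp [countFactor_pair, h]
      | [x + 2, y], _ =>
        have h : ∀ k, pd k ≠ x + 2 := fun k => by have := pd_lt_two k; omega
        simp [countFactor_pair, h]
      | [x, y + 2], _ =>
        have h : ∀ k, pd k ≠ y + 2 := fun k => by have := pd_lt_two k; omega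
        simp [countFactor_pair, h]
      | _ :: _ :: _ :: _, hv => simp at hv
    · rfl

theorem abel2Complexity_pd_succ_eq_ncard (n : ℕ) :
    abel2Complexity pd (n + 1) = (Set.range (profile n)).ncard := by
  set F : ℕ → List ℕ → ℕ := fun i v =>
    if v.length ≤ 2 then countFactor (factorAt pd i (n + 1)) v else 0
  have hF : ∀ i j, F i = F j ↔ profile n i = profile n j := profile_eq_iff n
  have hset : abel2Complexity pd (n + 1) = (Set.range F).ncard := by
    rw [abel2Complexity]
    congr 1
    ext f
    exact exists_congr fun i => eq_comm
  rw [hset]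
  refine Set.ncard_congr (fun f hf => profile n hf.choose) (fun f hf => ⟨_, rfl⟩) ?_ ?_
  · intro f g hf hg h
    rw [← hf.choose_spec, ← hg.choose_spec]
    exact (hF _ _).2 h
  · rintro _ ⟨i, rfl⟩
    exact ⟨F i, ⟨i, rfl⟩, (hF _ _).1 (Exists.choose_spec (⟨i, rfl⟩ : ∃ j, F j = F i))⟩

theorem mem_range_profile {n a b : ℕ} {N : ℤ} :
    (a, b, N) ∈ Set.range (profile n) ↔ N ∈ onesSet a b (n + 1) := by
  constructor
  · rintro ⟨i, h⟩
    simp only [profile, Prod.mk.injEq] at h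
    exact ⟨i, i + n, rfl, h.1, h.2.1, h.2.2.symm⟩
  · rintro ⟨i, j, h, rfl, rfl, rfl⟩
    obtain rfl : j = i + n := by omega
    exact ⟨i, rfl⟩

theorem abel2Complexity_pd {n : ℕ} (hn : 0 < n) :
    (abel2Complexity pd n : ℤ) = 3 * pdWidth n + 3 + parity n * (pdWidth n - 2 - 3 * maxStep n)
      - zeroGap n - 2 * evenStep n - oneGap n := by
  obtain ⟨n, rfl⟩ : ∃ k, n = k + 1 := ⟨n - 1, by omega⟩
  rw [abel2Complexity_pd_succ_eq_ncard]
  set A := pdMin (n + 1)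
  set B := pdMax (n + 1)
  set I₀ := Finset.Icc A (B - maxStep (n + 1) - zeroGap (n + 1))
  set I₁ := Finset.Icc (A + evenStep (n + 1) + parity (n + 1)) (B - maxStep (n + 1))
  set I₂ := if parity (n + 1) = 1 then Finset.Icc (A + 1 + oneGap (n + 1)) B else ∅
  have hset : Set.range (profile n) = (({0} ×ˢ {0} ×ˢ I₀ ∪ {0} ×ˢ {1} ×ˢ I₁ ∪
      ({1} ×ˢ {0} ×ˢ I₁ ∪ {1} ×ˢ {1} ×ˢ I₂) : Finset (ℕ × ℕ × ℤ)) : Set (ℕ × ℕ × ℤ)) := by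
    ext ⟨a, b, N⟩
    obtain ⟨h₁, h₂, h₃, h₄⟩ := mem_onesSet_iff hn N
    have h₀ : N ∈ I₀ ↔ N ∈ onesSet 0 0 (n + 1) := by rw [h₁, Finset.mem_Icc]
    have h₁ : N ∈ I₁ ↔ N ∈ onesSet 0 1 (n + 1) := by rw [h₂, Finset.mem_Icc]
    have h₁' : N ∈ I₁ ↔ N ∈ onesSet 1 0 (n + 1) := by rw [h₃, Finset.mem_Icc]
    have h₂ : N ∈ I₂ ↔ N ∈ onesSet 1 1 (n + 1) := by
      rw [h₄]
      simp only [I₂]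
      split_ifs with h <;> simp [h, A, B]
    have hab : N ∈ onesSet a b (n + 1) → a < 2 ∧ b < 2 := by
      rintro ⟨i, j, -, rfl, rfl, -⟩
      exact ⟨pd_lt_two i, pd_lt_two j⟩
    rw [mem_range_profile]
    simp only [Finset.coe_union, Set.mem_union, Finset.mem_coe, Finset.mem_product,
      Finset.mem_singleton]
    constructor
    · intro h
      obtain ⟨ha, hb⟩ := hab h
      interval_cases a <;> interval_cases b
      exacts [.inl (.inl ⟨rfl, rfl, h₀.2 h⟩), .inl (.inr ⟨rfl, rfl, h₁.2 h⟩),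
        .inr (.inl ⟨rfl, rfl, h₁'.2 h⟩), .inr (.inr ⟨rfl, rfl, h₂.2 h⟩)]
    · rintro ((⟨rfl, rfl, h⟩ | ⟨rfl, rfl, h⟩) | (⟨rfl, rfl, h⟩ | ⟨rfl, rfl, h⟩))
      exacts [h₀.1 h, h₁.1 h, h₁'.1 h, h₂.1 h]
  have hcard : (Set.range (profile n)).ncard = I₀.card + I₁.card + (I₁.card + I₂.card) := by
    rw [hset, Set.ncard_coe_finset, Finset.card_union_of_disjoint,
      Finset.card_union_of_disjoint, Finset.card_union_of_disjoint]
    · simp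
    all_goals
      rw [Finset.disjoint_left]
      rintro ⟨a, b, N⟩
      simp only [Finset.mem_union, Finset.mem_product, Finset.mem_singleton]
      omega
  have hW : pdWidth (n + 1) = B - A := rfl
  have hW' := pdWidth_pos hn
  have hc := maxStep_eq_or (n + 1)
  have hd := zeroGap_eq (n + 1)
  have hb := evenStep_eq (n + 1)
  have hg := oneGap_eq (n + 1)
  have he := parity_eq (n + 1)
  rw [hW] at hW'
  have card₀ : (I₀.card : ℤ) = B - maxStep (n + 1) - zeroGap (n + 1) + 1 - A :=
    Int.card_Icc_of_le _ _ (by omega)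
  have card₁ : (I₁.card : ℤ) =
      B - maxStep (n + 1) + 1 - (A + evenStep (n + 1) + parity (n + 1)) :=
    Int.card_Icc_of_le _ _ (by omega)
  have card₂ : (I₂.card : ℤ) = parity (n + 1) * (B + 1 - (A + 1 + oneGap (n + 1))) := by
    simp only [I₂]
    split_ifs with h
    · rw [h, one_mul]
      exact Int.card_Icc_of_le _ _ (by omega)
    · rw [he.resolve_right h]; simp
  rw [hcard, hW]
  push_cast
  rw [card₀, card₁, card₂]
  rcases he with he | he <;> rw [he] <;> omega

end Counting

section Generators

/-- The shift `n ↦ f (n + 1)` of a sequence. -/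
def shift (f : ℕ → ℤ) (n : ℕ) : ℤ := f (n + 1)

/-- The restriction of a sequence to the odd integers. -/
def oddPart (f : ℕ → ℤ) (n : ℕ) : ℤ := parity n * f n

theorem oddPart_even (f : ℕ → ℤ) (n : ℕ) : oddPart f (2 * n) = 0 := by
  rw [oddPart, parity_even, zero_mul]

theorem oddPart_odd (f : ℕ → ℤ) (n : ℕ) : oddPart f (2 * n + 1) = f (2 * n + 1) := by
  rw [oddPart, parity_odd, one_mul]

theorem shift_even (f : ℕ → ℤ) (n : ℕ) : shift f (2 * n) = f (2 * n + 1) := rfl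

theorem shift_odd (f : ℕ → ℤ) (n : ℕ) : shift f (2 * n + 1) = f (2 * (n + 1)) := rfl

/-- Generators of a module of sequences stable under `n ↦ 2 * n` and `n ↦ 2 * n + 1`. -/
def generators : Set (ℕ → ℤ) :=
  {1, parity, Pi.single 0 1, pdWidth, oddPart pdWidth, evenStep, shift evenStep, maxStep,
    shift maxStep, zeroGap, shift zeroGap, oneGap}

theorem single_zero_even (n : ℕ) :
    (Pi.single 0 1 : ℕ → ℤ) (2 * n) = (Pi.single 0 1 : ℕ → ℤ) n := by
  simp [Pi.single_apply]

theorem single_zero_odd (n : ℕ) : (Pi.single 0 1 : ℕ → ℤ) (2 * n + 1) = 0 := by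
  simp

theorem generators_even_mem : ∀ g ∈ generators,
    (fun n => g (2 * n)) ∈ Submodule.span ℤ generators := by
  have mem : ∀ g ∈ generators, g ∈ Submodule.span ℤ generators :=
    fun g hg => Submodule.subset_span hg
  have hm : 1 - parity + shift evenStep ∈ Submodule.span ℤ generators :=
    add_mem (sub_mem (mem _ (by simp [generators])) (mem _ (by simp [generators])))
      (mem _ (by simp [generators]))
  rintro g (rfl | rfl | rfl | rfl | rfl | rfl | rfl | rfl | rfl | rfl | rfl | rfl)
  · exact mem 1 (by simp [generators])
  · simp only [parity_even]; exact zero_mem _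
  · simp only [single_zero_even]; exact mem _ (by simp [generators])
  · simp only [pdWidth_even]; exact mem _ (by simp [generators])
  · simp only [oddPart_even]; exact zero_mem _
  · simp only [evenStep_even]; exact mem _ (by simp [generators])
  · simp only [shift_even, evenStep_odd]; exact zero_mem _
  · simp only [maxStep_even]; exact zero_mem _
  · simp only [shift_even, maxStep_odd]; exact hm
  · simp only [zeroGap_even]
    exact add_mem (mem evenStep (by simp [generators])) (mem parity (by simp [generators]))
  · simp only [shift_even, zeroGap_odd]; exact zero_mem _
  · simp only [oneGap_even]; exact zero_mem _

theorem generators_odd_mem : ∀ g ∈ generators,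
    (fun n => g (2 * n + 1)) ∈ Submodule.span ℤ generators := by
  have mem : ∀ g ∈ generators, g ∈ Submodule.span ℤ generators :=
    fun g hg => Submodule.subset_span hg
  have hm : 1 - parity + shift evenStep ∈ Submodule.span ℤ generators :=
    add_mem (sub_mem (mem _ (by simp [generators])) (mem _ (by simp [generators])))
      (mem _ (by simp [generators]))
  have hW := add_mem (mem pdWidth (by simp [generators])) hm
  rintro g (rfl | rfl | rfl | rfl | rfl | rfl | rfl | rfl | rfl | rfl | rfl | rfl)
  · exact mem 1 (by simp [generators])
  · simp only [parity_odd]; exact mem 1 (by simp [generators])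
  · simp only [single_zero_odd]; exact zero_mem _
  · simp only [pdWidth_odd]; exact hW
  · simp only [oddPart_odd, pdWidth_odd]; exact hW
  · simp only [evenStep_odd]; exact zero_mem _
  · simp only [shift_odd, evenStep_even]; exact mem (shift maxStep) (by simp [generators])
  · simp only [maxStep_odd]; exact hm
  · simp only [shift_odd, maxStep_even]; exact zero_mem _
  · simp only [zeroGap_odd]; exact zero_mem _
  · simp only [shift_odd, zeroGap_even, parity_succ]
    convert hm using 1
    ext n
    simp [shift]
    ring
  · simp only [oneGap_odd]; exact mem (shift zeroGap) (by simp [generators])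

theorem abel2Complexity_zero (w : ℕ → ℕ) : abel2Complexity w 0 = 1 := by
  simp [abel2Complexity, factorAt]

theorem abel2Complexity_pd_eq : (fun n => (abel2Complexity pd n : ℤ)) =
    (3 : ℤ) • pdWidth + (3 : ℤ) • 1 + oddPart pdWidth - (2 : ℤ) • parity - (3 : ℤ) • maxStep
      - zeroGap - (2 : ℤ) • evenStep - oneGap - (2 : ℤ) • Pi.single 0 1 := by
  ext n
  rcases n.eq_zero_or_pos with rfl | hn
  · have h₁ : maxStep 0 = 0 := maxStep_even 0
    have h₂ : evenStep 0 = 0 := (evenStep_even 0).trans h₁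
    have h₃ : parity 0 = 0 := parity_even 0
    have h₄ : zeroGap 0 = 0 := by simpa [h₂, h₃] using zeroGap_even 0
    have h₅ : oneGap 0 = 0 := oneGap_even 0
    have h₆ : pdWidth 0 = 0 := by simp [pdWidth, pdMax, pdMin]
    simp [abel2Complexity_zero, oddPart, h₁, h₂, h₃, h₄, h₅, h₆]
  · rw [abel2Complexity_pd hn]
    have hc : parity n * maxStep n = maxStep n := by
      rcases maxStep_eq_or n with h | ⟨h, h'⟩ <;> simp [*]
    simp [hn.ne', oddPart]
    linear_combination -3 * hc

end Generators

theorem stmt15 : IsTwoRegular fun n => (abel2Complexity pd n : ℤ) := by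
  have mem : ∀ g ∈ generators, g ∈ Submodule.span ℤ generators :=
    fun g hg => Submodule.subset_span hg
  refine isTwoRegular_of_mem (Submodule.fg_span (by simp [generators]))
    (mem_span_comp _ generators_even_mem) (mem_span_comp _ generators_odd_mem) ?_
  rw [abel2Complexity_pd_eq]
  have smul_mem : ∀ (c : ℤ), ∀ g ∈ generators, c • g ∈ Submodule.span ℤ generators :=
    fun c g hg => Submodule.smul_mem _ c (mem g hg)
  refine sub_mem (sub_mem (sub_mem (sub_mem (sub_mem (sub_mem (add_mem (add_mem
    (smul_mem _ _ ?_) (smul_mem _ _ ?_)) (mem _ ?_)) (smul_mem _ _ ?_)) (smul_mem _ _ ?_))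
    (mem _ ?_)) (smul_mem _ _ ?_)) (mem _ ?_)) (smul_mem _ _ ?_)
  all_goals simp [generators]
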